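/- Let u be a Q-minimizer of J on ℝ^n (i.e. Ω = ℝ^n). There exist constants c₁ > 0 and C₀ > 0, depending only on n, p, m, Q, such that for all integers T ≥ 1 and R ≥ 2T, c₁ · ( ( M_{R−T} − C₀·T·R^{n−1} )⁺ )^{(n−1)/n} ≤ R^{n−1}·T^{−γ} + M_{R+1} − M_R, where s⁺ = max(s,0). -/

import Mathlib

open MeasureTheory Metric Set

noncomputable section

/-- The energy `J(v,A) = ∫_A (|∇v|^p + (1-v²)^m) dx`. -/
def Jpm {n : ℕ} (p m : ℝ) (v : EuclideanSpace ℝ (Fin n) → ℝ)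
    (A : Set (EuclideanSpace ℝ (Fin n))) : ℝ :=
  ∫ x in A, (‖gradient v x‖ ^ p + (1 - (v x) ^ 2) ^ m)

/-- `u` is a `Q`-minimizer of `Jpm p m` in the whole space `ℝⁿ`. -/
def IsQMinEntire {n : ℕ} (p m Q : ℝ) (u : EuclideanSpace ℝ (Fin n) → ℝ) : Prop :=
  ∀ Ω' : Set (EuclideanSpace ℝ (Fin n)), IsOpen Ω' → Bornology.IsBounded Ω' →
    ∀ v : EuclideanSpace ℝ (Fin n) → ℝ,
      (∀ x, v x ∈ Icc (-1 : ℝ) 1) → LocallyLipschitz v →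
      (∀ x ∉ Ω', v x = u x) →
      Jpm p m u Ω' ≤ Q * Jpm p m v Ω'

/-- `V_r = |B_r ∩ {u ≥ 0}|`. -/
def Vvol {n : ℕ} (u : EuclideanSpace ℝ (Fin n) → ℝ) (r : ℝ) : ℝ :=
  (volume (ball (0 : EuclideanSpace ℝ (Fin n)) r ∩ {x | 0 ≤ u x})).toReal

/-- `P_r = ∫_{B_r} W(u) dx` with `W(τ) = (1-τ²)^m`. -/
def Ppot {n : ℕ} (m : ℝ) (u : EuclideanSpace ℝ (Fin n) → ℝ) (r : ℝ) : ℝ :=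
  ∫ x in ball (0 : EuclideanSpace ℝ (Fin n)) r, (1 - (u x) ^ 2) ^ m

/-- The weighted mixture `M_r = Σ_{j=0}^{T} ( P_{r-j} + (1+j)^{-pm/(m-p)} V_{r-j} )`. -/
def Mseq {n : ℕ} (p m : ℝ) (u : EuclideanSpace ℝ (Fin n) → ℝ) (T : ℕ) (r : ℝ) : ℝ :=
  ∑ j ∈ Finset.range (T + 1),
    (Ppot m u (r - j) + ((1 : ℝ) + j) ^ (-(p * m / (m - p))) * Vvol u (r - j))

theorem LocallyLipschitz.exists_lipschitzOnWith_closedBall {E F : Type*} [PseudoMetricSpace E]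
    [ProperSpace E] [PseudoMetricSpace F] {f : E → F} (hf : LocallyLipschitz f) (x : E) (r : ℝ) :
    ∃ K, LipschitzOnWith K f (closedBall x r) :=
  LocallyLipschitzOn.exists_lipschitzOnWith_of_compact (isCompact_closedBall x r)
    hf.locallyLipschitzOn

theorem LocallyLipschitz.ae_differentiableAt {E F : Type*} [NormedAddCommGroup E]
    [NormedSpace ℝ E] [FiniteDimensional ℝ E] [MeasurableSpace E] [BorelSpace E]
    [NormedAddCommGroup F] [NormedSpace ℝ F] [FiniteDimensional ℝ F]
    {f : E → F} (hf : LocallyLipschitz f) (μ : Measure E) [μ.IsAddHaarMeasure] :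
    ∀ᵐ x ∂μ, DifferentiableAt ℝ f x := by
  have : ∀ k : ℕ, ∀ᵐ x ∂μ, x ∈ ball (0 : E) k → DifferentiableAt ℝ f x := by
    intro k
    obtain ⟨K, hK⟩ := hf.exists_lipschitzOnWith_closedBall (0 : E) k
    filter_upwards [(hK.mono ball_subset_closedBall).ae_differentiableWithinAt_of_mem (μ := μ)]
      with x hx hxk
    exact (hx hxk).differentiableAt (isOpen_ball.mem_nhds hxk)
  filter_upwards [ae_all_iff.2 this] with x hx
  obtain ⟨k, hk⟩ := exists_nat_gt ‖x‖
  exact hx k (by simpa using hk)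

theorem LipschitzOnWith.norm_fderiv_le_of_mem_ball {E F : Type*} [NormedAddCommGroup E]
    [NormedSpace ℝ E] [NormedAddCommGroup F] [NormedSpace ℝ F] {f : E → F} {K : NNReal}
    {c x : E} {r : ℝ} (hf : LipschitzOnWith K f (closedBall c r)) (hx : x ∈ ball c r) :
    ‖fderiv ℝ f x‖ ≤ K :=
  norm_fderiv_le_of_lipschitzOn ℝ
    (Filter.mem_of_superset (isOpen_ball.mem_nhds hx) ball_subset_closedBall) hf

section Sobolev

open scoped Convolution ENNReal NNReal Topology
open Filter

variable {E : Type*} [NormedAddCommGroup E] [NormedSpace ℝ E] [FiniteDimensional ℝ E]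
  [MeasurableSpace E] [BorelSpace E] {f : E → ℝ} (μ : Measure E) [μ.IsAddHaarMeasure]

theorem LocallyLipschitz.hasFDerivAt_convolution (hf : LocallyLipschitz f) (φ : ContDiffBump (0 : E))
    (x : E) :
    HasFDerivAt (φ.normed μ ⋆[ContinuousLinearMap.lsmul ℝ ℝ, μ] f)
      (∫ y, φ.normed μ y • fderiv ℝ f (x - y) ∂μ) x := by
  obtain ⟨K, hK⟩ := hf.exists_lipschitzOnWith_closedBall x (1 + φ.rOut)
  have hc := hf.continuous
  have hcφ := φ.continuous_normed (μ := μ)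
  refine (hasFDerivAt_integral_of_dominated_loc_of_lip (s := ball x 1)
    (F := fun z y ↦ φ.normed μ y • f (z - y))
    (bound := fun y ↦ φ.normed μ y * K) (ball_mem_nhds x one_pos) ?_ ?_ ?_ ?_ ?_ ?_).2
  · refine Eventually.of_forall fun z ↦ Continuous.aestronglyMeasurable ?_
    fun_prop
  · refine Continuous.integrable_of_hasCompactSupport (by fun_prop) ?_
    exact φ.hasCompactSupport_normed.smul_right
  · refine (hcφ.measurable.smul ?_).aestronglyMeasurable
    exact (measurable_fderiv ℝ f).comp (measurable_const.sub measurable_id)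
  · refine Eventually.of_forall fun y ↦ LipschitzOnWith.of_dist_le_mul fun a ha b hb ↦ ?_
    by_cases hy : φ.normed μ y = 0
    · simp [hy]
    have hyb : ‖y‖ < φ.rOut := by
      have : y ∈ Function.support (φ.normed μ) := hy
      rw [φ.support_normed_eq] at this
      simpa using this
    have key : ∀ a ∈ ball x 1, a - y ∈ closedBall x (1 + φ.rOut) := by
      intro a ha
      rw [mem_closedBall, dist_eq_norm]
      rw [mem_ball, dist_eq_norm] at ha
      calc ‖a - y - x‖ = ‖(a - x) - y‖ := by congr 1; abel
        _ ≤ ‖a - x‖ + ‖y‖ := norm_sub_le _ _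
        _ ≤ _ := by linarith
    have := hK.dist_le_mul _ (key a ha) _ (key b hb)
    rw [dist_sub_right] at this
    have h0 : 0 ≤ φ.normed μ y := φ.nonneg_normed y
    rw [Real.coe_nnabs, abs_of_nonneg (by positivity), dist_smul₀, Real.norm_of_nonneg h0, mul_assoc]
    gcongr
  · exact (φ.integrable_normed).mul_const _
  · have h1 := hf.ae_differentiableAt μ
    have h2 : ∀ᵐ y ∂μ, DifferentiableAt ℝ f (x - y) :=
      (quasiMeasurePreserving_sub_left μ x).ae h1
    filter_upwards [h2] with y hy
    have := hy.hasFDerivAt.comp x ((hasFDerivAt_id x).sub_const y)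
    exact this.const_smul (φ.normed μ y)

theorem LocallyLipschitz.lintegral_fderiv_convolution_le (hf : LocallyLipschitz f)
    (φ : ContDiffBump (0 : E)) :
    ∫⁻ x, ‖fderiv ℝ (φ.normed μ ⋆[ContinuousLinearMap.lsmul ℝ ℝ, μ] f) x‖ₑ ∂μ ≤
      ∫⁻ x, ‖fderiv ℝ f x‖ₑ ∂μ := by
  have hφ : Measurable fun y ↦ ‖φ.normed μ y‖ₑ := φ.continuous_normed.measurable.enorm
  have hf' : Measurable fun y ↦ ‖fderiv ℝ f y‖ₑ := (measurable_fderiv ℝ f).enorm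
  calc ∫⁻ x, ‖fderiv ℝ (φ.normed μ ⋆[ContinuousLinearMap.lsmul ℝ ℝ, μ] f) x‖ₑ ∂μ
      ≤ ∫⁻ x, ∫⁻ y, ‖φ.normed μ y‖ₑ * ‖fderiv ℝ f (x - y)‖ₑ ∂μ ∂μ := by
        refine lintegral_mono fun x ↦ ?_
        rw [(hf.hasFDerivAt_convolution μ φ x).fderiv]
        refine (enorm_integral_le_lintegral_enorm _).trans_eq ?_
        simp only [enorm_smul]
    _ = ∫⁻ y, ∫⁻ x, ‖φ.normed μ y‖ₑ * ‖fderiv ℝ f (x - y)‖ₑ ∂μ ∂μ := by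
        refine lintegral_lintegral_swap (Measurable.aemeasurable ?_)
        exact (hφ.comp measurable_snd).mul (hf'.comp (measurable_fst.sub measurable_snd))
    _ = ∫⁻ y, ‖φ.normed μ y‖ₑ * ∫⁻ x, ‖fderiv ℝ f x‖ₑ ∂μ ∂μ := by
        refine lintegral_congr fun y ↦ ?_
        have : Measurable fun x ↦ ‖fderiv ℝ f (x - y)‖ₑ := hf'.comp (measurable_id.sub_const y)
        rw [lintegral_const_mul _ this,
          lintegral_sub_right_eq_self (fun x ↦ ‖fderiv ℝ f x‖ₑ) y]
    _ = ∫⁻ x, ‖fderiv ℝ f x‖ₑ ∂μ := by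
        rw [lintegral_mul_const _ hφ, ← ofReal_integral_norm_eq_lintegral_enorm φ.integrable_normed]
        simp only [Real.norm_of_nonneg (φ.nonneg_normed _), φ.integral_normed, ENNReal.ofReal_one,
          one_mul]

/-- The Gagliardo–Nirenberg–Sobolev inequality for locally Lipschitz functions with compact
support. -/
theorem LocallyLipschitz.lintegral_pow_le_pow_lintegral_fderiv (hf : LocallyLipschitz f)
    (hfs : HasCompactSupport f) {p : ℝ} (hp : Real.HolderConjugate (Module.finrank ℝ E) p) :
    ∫⁻ x, ‖f x‖ₑ ^ p ∂μ ≤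
      lintegralPowLePowLIntegralFDerivConst μ p * (∫⁻ x, ‖fderiv ℝ f x‖ₑ ∂μ) ^ p := by
  let φ : ℕ → ContDiffBump (0 : E) := fun k ↦
    ⟨1 / (2 * ((k : ℝ) + 1)), 1 / ((k : ℝ) + 1), by positivity, by
      apply one_div_lt_one_div_of_lt <;> nlinarith [Nat.cast_nonneg (α := ℝ) k]⟩
  have hφ : Tendsto (fun k ↦ (φ k).rOut) atTop (𝓝 0) := tendsto_one_div_add_atTop_nhds_zero_nat
  let g : ℕ → E → ℝ := fun k ↦ (φ k).normed μ ⋆[ContinuousLinearMap.lsmul ℝ ℝ, μ] f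
  have hg : ∀ k, ContDiff ℝ 1 (g k) := fun k ↦
    (φ k).hasCompactSupport_normed.contDiff_convolution_left _ (φ k).contDiff_normed
      hf.continuous.locallyIntegrable
  have hlim : ∀ x, Tendsto (fun k ↦ g k x) atTop (𝓝 (f x)) := fun x ↦
    ContDiffBump.convolution_tendsto_right_of_continuous hφ hf.continuous x
  have hp0 : 0 ≤ p := hp.symm.nonneg
  calc ∫⁻ x, ‖f x‖ₑ ^ p ∂μ = ∫⁻ x, liminf (fun k ↦ ‖g k x‖ₑ ^ p) atTop ∂μ := by
        refine lintegral_congr fun x ↦ (Tendsto.liminf_eq ?_).symm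
        exact ((ENNReal.continuous_rpow_const (y := p)).tendsto _).comp (hlim x).enorm
    _ ≤ liminf (fun k ↦ ∫⁻ x, ‖g k x‖ₑ ^ p ∂μ) atTop :=
        lintegral_liminf_le fun k ↦ ((hg k).continuous.measurable.enorm).pow_const p
    _ ≤ _ := by
        refine (liminf_le_liminf (Eventually.of_forall fun k ↦ ?_)).trans_eq (liminf_const _)
        refine (MeasureTheory.lintegral_pow_le_pow_lintegral_fderiv μ (hg k)
          ((φ k).hasCompactSupport_normed.convolution _ hfs) hp).trans ?_
        exact mul_le_mul' le_rfl
          (ENNReal.rpow_le_rpow (hf.lintegral_fderiv_convolution_le μ (φ k)) hp0)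

end Sobolev

section Barrier

variable {E : Type*} [NormedAddCommGroup E] {a κ ρ : ℝ}

/-- The distance from `x` to the complement of the ball of radius `ρ`. -/
def depth (ρ : ℝ) (x : E) : ℝ := max (ρ - ‖x‖) 0

/-- A radial barrier equal to `1` outside the ball of radius `ρ`, decaying to `-1` inside it like
the power `-κ` of the depth. -/
def barrier (a κ ρ : ℝ) (x : E) : ℝ := -1 + 2 * (1 + a * depth ρ x) ^ (-κ)

theorem depth_nonneg (ρ : ℝ) (x : E) : 0 ≤ depth ρ x := le_max_right _ _

theorem depth_of_lt {x : E} (hx : ‖x‖ < ρ) : depth ρ x = ρ - ‖x‖ :=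
  max_eq_left (sub_nonneg.2 hx.le)

theorem lipschitzWith_depth (ρ : ℝ) : LipschitzWith 1 (depth ρ : E → ℝ) :=
  (LipschitzWith.of_dist_le_mul fun x y ↦ by
    simpa [dist_eq_norm] using abs_norm_sub_norm_le y x |>.trans_eq (norm_sub_rev _ _)
    : LipschitzWith 1 fun x : E ↦ ρ - ‖x‖).max_const 0

theorem continuous_depth (ρ : ℝ) : Continuous (depth ρ : E → ℝ) := (lipschitzWith_depth ρ).continuous

theorem one_le_one_add_mul_depth (ha : 1 ≤ a) (ρ : ℝ) (x : E) : 1 ≤ 1 + a * depth ρ x :=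
  le_add_of_nonneg_right (mul_nonneg (by linarith) (depth_nonneg ρ x))

theorem barrier_mem_Icc (ha : 1 ≤ a) (hκ : 0 < κ) (ρ : ℝ) (x : E) :
    barrier a κ ρ x ∈ Icc (-1 : ℝ) 1 := by
  have h1 := one_le_one_add_mul_depth ha ρ x
  have h2 := Real.rpow_le_one_of_one_le_of_nonpos h1 (neg_nonpos.2 hκ.le)
  have h3 : 0 ≤ (1 + a * depth ρ x) ^ (-κ) := by positivity
  constructor <;> simp only [barrier] <;> linarith

theorem barrier_of_le {x : E} (hx : ρ ≤ ‖x‖) : barrier a κ ρ x = 1 := by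
  have : depth ρ x = 0 := max_eq_right (sub_nonpos.2 hx)
  simp only [barrier, this, mul_zero, add_zero, Real.one_rpow]
  norm_num

theorem locallyLipschitz_barrier (ha : 1 ≤ a) (κ ρ : ℝ) :
    LocallyLipschitz (barrier a κ ρ : E → ℝ) := by
  intro x
  have h1 := one_le_one_add_mul_depth ha ρ x
  have h2 : ContDiffAt ℝ 1 (fun t : ℝ ↦ -1 + 2 * (1 + a * t) ^ (-κ)) (depth ρ x) := by
    refine contDiffAt_const.add (contDiffAt_const.mul ?_)
    exact ContDiffAt.rpow_const_of_ne (by fun_prop) (by positivity)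
  obtain ⟨K, t, ht, hK⟩ := h2.exists_lipschitzOnWith
  refine ⟨K * 1, depth ρ ⁻¹' t, (continuous_depth ρ).continuousAt.preimage_mem_nhds ht, ?_⟩
  exact hK.comp (lipschitzWith_depth ρ).lipschitzOnWith (mapsTo_preimage _ _)

theorem barrier_add_one_le (ha : 1 ≤ a) (hκ : 0 < κ) (ρ : ℝ) (x : E) :
    1 + barrier a κ ρ x ≤ 2 * (1 + depth ρ x) ^ (-κ) := by
  have h0 := depth_nonneg ρ x
  have : (1 + a * depth ρ x) ^ (-κ) ≤ (1 + depth ρ x) ^ (-κ) :=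
    Real.rpow_le_rpow_of_nonpos (by positivity) (by nlinarith) (neg_nonpos.2 hκ.le)
  simp only [barrier]
  linarith

theorem le_barrier_add_one (ha : 1 ≤ a) (hκ : 0 < κ) (hak : a ^ (-κ) = 1 / 4) (ρ : ℝ) (x : E) :
    1 / 2 * (1 + depth ρ x) ^ (-κ) ≤ 1 + barrier a κ ρ x := by
  have h0 := depth_nonneg ρ x
  have h1 : (a * (1 + depth ρ x)) ^ (-κ) ≤ (1 + a * depth ρ x) ^ (-κ) :=
    Real.rpow_le_rpow_of_nonpos (by positivity) (by nlinarith) (neg_nonpos.2 hκ.le)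
  rw [Real.mul_rpow (by positivity) (by positivity), hak] at h1
  simp only [barrier]
  linarith

theorem barrier_le_of_norm_le (ha : 1 ≤ a) (hκ : 0 < κ) (hak : a ^ (-κ) = 1 / 4) {x : E}
    (hx : ‖x‖ ≤ ρ - 1) : barrier a κ ρ x ≤ -(1 / 2) := by
  have h0 : 1 ≤ depth ρ x := le_max_of_le_left (by linarith)
  have h1 : (1 + a * depth ρ x) ^ (-κ) ≤ a ^ (-κ) :=
    Real.rpow_le_rpow_of_nonpos (by positivity) (by nlinarith) (neg_nonpos.2 hκ.le)
  simp only [barrier]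
  linarith

theorem norm_fderiv_barrier_le [NormedSpace ℝ E] (ha : 1 ≤ a) (hκ : 0 < κ) {x : E} (hx : ‖x‖ < ρ)
    (hd : DifferentiableAt ℝ (fun y : E ↦ ‖y‖) x) :
    ‖fderiv ℝ (barrier a κ ρ) x‖ ≤ 2 * κ * a * (1 + depth ρ x) ^ (-κ - 1) := by
  have h1 := one_le_one_add_mul_depth ha ρ x
  have h0 := depth_nonneg ρ x
  have hdd : DifferentiableAt ℝ (depth ρ) x := by
    refine (hd.const_sub ρ).congr_of_eventuallyEq ?_
    filter_upwards [continuous_norm.continuousAt.eventually_lt_const hx] with y hy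
    exact depth_of_lt hy
  have hF : HasDerivAt (fun t : ℝ ↦ -1 + 2 * (1 + a * t) ^ (-κ))
      (2 * (a * -κ * (1 + a * depth ρ x) ^ (-κ - 1))) (depth ρ x) := by
    refine (HasDerivAt.const_mul 2 ?_).const_add (-1)
    refine HasDerivAt.rpow_const ?_ (Or.inl (by positivity))
    simpa using ((hasDerivAt_id (depth ρ x)).const_mul a).const_add 1
  have hc : HasFDerivAt (barrier a κ ρ) _ x := hF.comp_hasFDerivAt x hdd.hasFDerivAt
  have hle : ‖fderiv ℝ (depth ρ) x‖ ≤ 1 := by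
    simpa using norm_fderiv_le_of_lipschitz ℝ (x₀ := x) (lipschitzWith_depth ρ)
  have hr : (1 + a * depth ρ x) ^ (-κ - 1) ≤ (1 + depth ρ x) ^ (-κ - 1) :=
    Real.rpow_le_rpow_of_nonpos (by positivity) (by nlinarith) (by linarith)
  rw [hc.fderiv, norm_smul, Real.norm_eq_abs]
  have habs : |2 * (a * -κ * (1 + a * depth ρ x) ^ (-κ - 1))| =
      2 * κ * a * (1 + a * depth ρ x) ^ (-κ - 1) := by
    rw [show 2 * (a * -κ * (1 + a * depth ρ x) ^ (-κ - 1)) =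
      -(2 * κ * a * (1 + a * depth ρ x) ^ (-κ - 1)) by ring, abs_neg, abs_of_nonneg (by positivity)]
  rw [habs]
  calc _ ≤ 2 * κ * a * (1 + a * depth ρ x) ^ (-κ - 1) * 1 := by gcongr
    _ ≤ _ := by rw [mul_one]; gcongr

theorem exists_rpow_neg_eq_quarter (hκ : 0 < κ) : ∃ a : ℝ, 1 ≤ a ∧ a ^ (-κ) = 1 / 4 := by
  refine ⟨4 ^ (1 / κ), Real.one_le_rpow (by norm_num) (by positivity), ?_⟩
  rw [← Real.rpow_mul (by norm_num), show 1 / κ * -κ = -1 by field_simp, Real.rpow_neg_one]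
  norm_num

variable {m α t : ℝ}

theorem potential_le_depth_rpow (ha : 1 ≤ a) (hκ : 0 < κ) (hm : 0 < m) {x : E}
    (h1 : -1 ≤ t) (h2 : t ≤ 1) (h : t ≤ barrier a κ ρ x) :
    (1 - t ^ 2) ^ m ≤ 4 ^ m * (1 + depth ρ x) ^ (-(κ * m)) := by
  have h0 := depth_nonneg ρ x
  have := barrier_add_one_le ha hκ ρ x
  calc (1 - t ^ 2) ^ m ≤ (4 * (1 + depth ρ x) ^ (-κ)) ^ m := by
        refine Real.rpow_le_rpow (by nlinarith) (by nlinarith) hm.le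
    _ = _ := by
        rw [Real.mul_rpow (by norm_num) (by positivity), ← Real.rpow_mul (by positivity), neg_mul]

theorem depth_rpow_le_potential (ha : 1 ≤ a) (hκ : 0 < κ) (hak : a ^ (-κ) = 1 / 4) (hm : 0 < m)
    {x : E} (h1 : t ≤ 0) (h : barrier a κ ρ x ≤ t) :
    (1 + depth ρ x) ^ (-(κ * m)) ≤ 2 ^ m * (1 - t ^ 2) ^ m := by
  have h0 := depth_nonneg ρ x
  have := le_barrier_add_one ha hκ hak ρ x
  have h3 : 0 ≤ (1 + depth ρ x) ^ (-κ) := by positivity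
  have h4 : 0 ≤ 1 - t ^ 2 := by nlinarith
  rw [← Real.mul_rpow (by norm_num) h4, ← neg_mul, Real.rpow_mul (by positivity)]
  exact Real.rpow_le_rpow h3 (by nlinarith) hm.le

end Barrier

section Series

variable {γ : ℝ}

theorem one_add_rpow_neg_le_sub (hγ : 0 < γ) {x : ℝ} (hx : 0 < x) :
    (1 + x) ^ (-(γ + 1)) ≤ γ⁻¹ * (x ^ (-γ) - (1 + x) ^ (-γ)) := by
  have hx1 : 0 < 1 + x := by positivity
  have h1 : x / (1 + x) ≤ Real.exp (-(1 + x)⁻¹) := by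
    have := Real.add_one_le_exp (-(1 + x)⁻¹)
    have h : x / (1 + x) = -(1 + x)⁻¹ + 1 := by field_simp; ring
    linarith
  have h2 : 1 + γ * (1 + x)⁻¹ ≤ (x / (1 + x)) ^ (-γ) := by
    calc 1 + γ * (1 + x)⁻¹ ≤ Real.exp (γ * (1 + x)⁻¹) := by
          linarith [Real.add_one_le_exp (γ * (1 + x)⁻¹)]
      _ = Real.exp (-(1 + x)⁻¹) ^ (-γ) := by rw [← Real.exp_mul]; ring_nf
      _ ≤ _ := Real.rpow_le_rpow_of_nonpos (by positivity) h1 (by linarith)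
  rw [Real.div_rpow hx.le hx1.le, le_div_iff₀ (by positivity)] at h2
  have h3 : (1 + x) ^ (-(γ + 1)) = (1 + x) ^ (-γ) * (1 + x)⁻¹ := by
    rw [neg_add, Real.rpow_add hx1, Real.rpow_neg_one]
  rw [h3, inv_mul_eq_div, le_div_iff₀ hγ]
  linarith

theorem sum_Ico_one_add_rpow_neg_le (hγ : 0 < γ) {T N : ℕ} (hT : 1 ≤ T) (hN : T + 1 ≤ N) :
    ∑ j ∈ Finset.Ico (T + 1) N, (1 + (j : ℝ)) ^ (-(γ + 1)) ≤ γ⁻¹ * (T : ℝ) ^ (-γ) := by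
  have h : ∑ j ∈ Finset.Ico (T + 1) N, (1 + (j : ℝ)) ^ (-(γ + 1)) ≤
      γ⁻¹ * ((T + 1 : ℕ) : ℝ) ^ (-γ) - γ⁻¹ * (N : ℝ) ^ (-γ) := by
    induction N, hN using Nat.le_induction with
    | base => simp
    | succ N hN ih =>
      rw [Finset.sum_Ico_succ_top hN]
      have hN0 : (0 : ℝ) < N := by exact_mod_cast (by omega : 0 < N)
      have := one_add_rpow_neg_le_sub hγ hN0
      push_cast
      push_cast at ih
      rw [add_comm (N : ℝ) 1]
      linarith
  have hT0 : (0 : ℝ) < T := by exact_mod_cast hT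
  have h1 : ((T + 1 : ℕ) : ℝ) ^ (-γ) ≤ (T : ℝ) ^ (-γ) :=
    Real.rpow_le_rpow_of_nonpos hT0 (by push_cast; linarith) (by linarith)
  have h2 : 0 ≤ γ⁻¹ * (N : ℝ) ^ (-γ) := by positivity
  have h3 := mul_le_mul_of_nonneg_left h1 (inv_nonneg.2 hγ.le)
  linarith

theorem sum_range_one_add_rpow_neg_le (hγ : 0 < γ) (N : ℕ) :
    ∑ j ∈ Finset.range N, (1 + (j : ℝ)) ^ (-(γ + 1)) ≤ 2 + γ⁻¹ := by
  have hpos : ∀ j : ℕ, 0 ≤ (1 + (j : ℝ)) ^ (-(γ + 1)) := fun j ↦ by positivity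
  have hle : ∀ j : ℕ, (1 + (j : ℝ)) ^ (-(γ + 1)) ≤ 1 := fun j ↦
    Real.rpow_le_one_of_one_le_of_nonpos (by linarith [Nat.cast_nonneg (α := ℝ) j]) (by linarith)
  calc _ ≤ ∑ j ∈ Finset.range (N + 2), (1 + (j : ℝ)) ^ (-(γ + 1)) :=
        Finset.sum_le_sum_of_subset_of_nonneg (Finset.range_mono (by omega)) fun j _ _ ↦ hpos j
    _ = ∑ j ∈ Finset.range 2, (1 + (j : ℝ)) ^ (-(γ + 1)) +
          ∑ j ∈ Finset.Ico (1 + 1) (N + 2), (1 + (j : ℝ)) ^ (-(γ + 1)) :=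
        (Finset.sum_range_add_sum_Ico _ (by omega)).symm
    _ ≤ 2 + γ⁻¹ := by
        gcongr
        · calc _ ≤ ∑ j ∈ Finset.range 2, (1 : ℝ) := Finset.sum_le_sum fun j _ ↦ hle j
            _ = 2 := by simp
        · simpa using sum_Ico_one_add_rpow_neg_le hγ le_rfl (by omega : 1 + 1 ≤ N + 2)

end Series

section Shells

variable {n : ℕ}

/-- The spherical shell between the radii `r` and `r + 1`. -/
def shell (n : ℕ) (r : ℝ) : Set (EuclideanSpace ℝ (Fin n)) := ball 0 (r + 1) \ ball 0 r

theorem measurableSet_shell (r : ℝ) : MeasurableSet (shell n r) :=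
  measurableSet_ball.diff measurableSet_ball

theorem volume_shell_lt_top (r : ℝ) : volume (shell n r) < ⊤ :=
  (measure_mono sdiff_subset).trans_lt measure_ball_lt_top

theorem volume_real_ball (hn : n ≠ 0) {r : ℝ} (hr : 0 ≤ r) :
    volume.real (ball (0 : EuclideanSpace ℝ (Fin n)) r) =
      r ^ n * volume.real (ball (0 : EuclideanSpace ℝ (Fin n)) 1) := by
  have : Nontrivial (EuclideanSpace ℝ (Fin n)) := by
    have : Nonempty (Fin n) := ⟨⟨0, Nat.pos_of_ne_zero hn⟩⟩
    infer_instance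
  rw [Measure.real, Measure.real, Measure.addHaar_ball volume _ hr, ENNReal.toReal_mul,
    finrank_euclideanSpace_fin, ENNReal.toReal_ofReal (by positivity)]

theorem volume_real_shell_le (hn : n ≠ 0) {r R : ℝ} (hr : 0 ≤ r) (hR : r + 1 ≤ R) :
    volume.real (shell n r) ≤
      n * R ^ (n - 1) * volume.real (ball (0 : EuclideanSpace ℝ (Fin n)) 1) := by
  rw [shell, measureReal_sdiff (ball_subset_ball (by linarith)) measurableSet_ball,
    volume_real_ball hn hr, volume_real_ball hn (by linarith), ← sub_mul]
  gcongr
  have := one_add_mul_le_pow (a := -(r + 1)⁻¹) (by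
    have : (r + 1)⁻¹ ≤ 1 := inv_le_one_of_one_le₀ (by linarith)
    linarith) n
  have h1 : 1 + -(r + 1)⁻¹ = r / (r + 1) := by field_simp; ring
  rw [h1, div_pow, le_div_iff₀ (by positivity)] at this
  have h2 : (r + 1)⁻¹ * (r + 1) ^ n = (r + 1) ^ (n - 1) := by
    rw [← mul_pow_sub_one hn (r + 1)]
    field_simp
  have h3 : (r + 1) ^ (n - 1) ≤ R ^ (n - 1) := by gcongr
  calc (r + 1) ^ n - r ^ n ≤ n * ((r + 1)⁻¹ * (r + 1) ^ n) := by linarith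
    _ ≤ _ := by rw [h2]; gcongr

theorem setIntegral_ball_inter_eq_sum_shell {f : EuclideanSpace ℝ (Fin n) → ℝ} (N : ℕ)
    {A : Set (EuclideanSpace ℝ (Fin n))} (hA : MeasurableSet A)
    (hf : IntegrableOn f (ball 0 N)) :
    ∫ x in ball 0 N ∩ A, f x = ∑ j ∈ Finset.range N, ∫ x in shell n (N - 1 - j) ∩ A, f x := by
  have key : ∀ j ∈ Finset.range N, ∫ x in shell n (N - 1 - j) ∩ A, f x =
      (∫ x in ball 0 ((N : ℝ) - j) ∩ A, f x) - ∫ x in ball 0 ((N : ℝ) - (j + 1 : ℕ)) ∩ A, f x := by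
    intro j _
    have hsub : ball (0 : EuclideanSpace ℝ (Fin n)) ((N : ℝ) - (j + 1 : ℕ)) ∩ A ⊆
        ball 0 ((N : ℝ) - j) ∩ A :=
      inter_subset_inter_left _ (ball_subset_ball (by push_cast; linarith))
    rw [← setIntegral_sdiff (measurableSet_ball.inter hA) (hf.mono_set ?_) hsub]
    · congr 2
      rw [shell, ← inter_sdiff_distrib_right]
      congr 3 <;> push_cast <;> ring
    · exact inter_subset_left.trans (ball_subset_ball (by linarith [Nat.cast_nonneg (α := ℝ) j]))
  rw [Finset.sum_congr rfl key,
    Finset.sum_range_sub' fun j : ℕ ↦ ∫ x in ball 0 ((N : ℝ) - j) ∩ A, f x]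
  simp

end Shells

section Energy

variable {n : ℕ} {p m Q a κ ρ : ℝ} {u v : EuclideanSpace ℝ (Fin n) → ℝ}
  {U : Set (EuclideanSpace ℝ (Fin n))}

theorem norm_gradient_eq (v : EuclideanSpace ℝ (Fin n) → ℝ) (x : EuclideanSpace ℝ (Fin n)) :
    ‖gradient v x‖ = ‖fderiv ℝ v x‖ := LinearIsometryEquiv.norm_map _ _

theorem one_sub_sq_nonneg_of_mem_Icc {t : ℝ} (ht : t ∈ Icc (-1 : ℝ) 1) : 0 ≤ 1 - t ^ 2 := by
  nlinarith [ht.1, ht.2]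

theorem potential_mem_Icc (hm : 0 ≤ m) {t : ℝ} (ht : t ∈ Icc (-1 : ℝ) 1) :
    (1 - t ^ 2) ^ m ∈ Icc (0 : ℝ) 1 :=
  ⟨Real.rpow_nonneg (one_sub_sq_nonneg_of_mem_Icc ht) _,
    Real.rpow_le_one (one_sub_sq_nonneg_of_mem_Icc ht) (by nlinarith) hm⟩

theorem integrableOn_potential (hm : 0 ≤ m) (hv : ∀ x, v x ∈ Icc (-1 : ℝ) 1) (hvc : Continuous v)
    (hU : Bornology.IsBounded U) : IntegrableOn (fun x ↦ (1 - v x ^ 2) ^ m) U := by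
  refine Measure.integrableOn_of_bounded (M := 1) hU.measure_lt_top.ne
    (Measurable.aestronglyMeasurable (by fun_prop)) (Filter.Eventually.of_forall fun x ↦ ?_)
  have := potential_mem_Icc hm (hv x)
  rw [Real.norm_of_nonneg this.1]
  exact this.2

theorem integrableOn_energy (hp : 0 ≤ p) (hm : 0 ≤ m) (hv : ∀ x, v x ∈ Icc (-1 : ℝ) 1)
    (hvl : LocallyLipschitz v) (hU : Bornology.IsBounded U) :
    IntegrableOn (fun x ↦ ‖gradient v x‖ ^ p + (1 - v x ^ 2) ^ m) U := by
  refine IntegrableOn.add ?_ (integrableOn_potential hm hv hvl.continuous hU)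
  obtain ⟨r, hr⟩ := hU.subset_ball 0
  obtain ⟨K, hK⟩ := hvl.exists_lipschitzOnWith_closedBall 0 r
  simp only [norm_gradient_eq]
  refine IntegrableOn.mono_set ?_ hr
  refine Measure.integrableOn_of_bounded (M := (K : ℝ) ^ p) measure_ball_lt_top.ne
    (((measurable_fderiv ℝ v).norm.pow_const p).aestronglyMeasurable) ?_
  refine (ae_restrict_iff' measurableSet_ball).2 (Filter.Eventually.of_forall fun x hx ↦ ?_)
  rw [Real.norm_of_nonneg (by positivity)]
  exact Real.rpow_le_rpow (norm_nonneg _) (hK.norm_fderiv_le_of_mem_ball hx) hp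

theorem Jpm_congr (hU : IsOpen U) (h : EqOn u v U) : Jpm p m u U = Jpm p m v U := by
  refine setIntegral_congr_fun hU.measurableSet fun x hx ↦ ?_
  have : u =ᶠ[nhds x] v := h.eventuallyEq_of_mem (hU.mem_nhds hx)
  simp only [norm_gradient_eq, this.fderiv_eq, h hx]

theorem setOf_barrier_lt_subset_ball (hu : ∀ x, u x ∈ Icc (-1 : ℝ) 1) :
    {x | barrier a κ ρ x < u x} ⊆ ball 0 ρ := by
  intro x hx
  rw [mem_ball_zero_iff]
  by_contra! h
  rw [mem_ofPred_eq, barrier_of_le h] at hx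
  exact absurd (hu x).2 (not_le.2 hx)

theorem isOpen_setOf_barrier_lt (ha : 1 ≤ a) (hul : LocallyLipschitz u) :
    IsOpen {x | barrier a κ ρ x < u x} :=
  isOpen_lt (locallyLipschitz_barrier ha κ ρ).continuous hul.continuous

theorem IsQMinEntire.Jpm_le_barrier (hmin : IsQMinEntire p m Q u) (hu : ∀ x, u x ∈ Icc (-1 : ℝ) 1)
    (hul : LocallyLipschitz u) (ha : 1 ≤ a) (hκ : 0 < κ) :
    Jpm p m u {x | barrier a κ ρ x < u x} ≤
      Q * Jpm p m (barrier a κ ρ) {x | barrier a κ ρ x < u x} := by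
  have hopen := isOpen_setOf_barrier_lt (κ := κ) (ρ := ρ) ha hul
  have h := hmin _ hopen
    (isBounded_ball.subset (setOf_barrier_lt_subset_ball hu)) (fun x ↦ min (u x) (barrier a κ ρ x))
    (fun x ↦ ⟨le_min (hu x).1 (barrier_mem_Icc ha hκ ρ x).1, min_le_of_left_le (hu x).2⟩)
    (hul.min (locallyLipschitz_barrier ha κ ρ)) (fun x hx ↦ min_eq_left (not_lt.1 hx))
  rwa [Jpm_congr (v := barrier a κ ρ) hopen fun x hx ↦ min_eq_right (le_of_lt hx)] at h

/-- The pointwise energy bound for the barrier. -/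
theorem energy_barrier_le (ha : 1 ≤ a) (hκ : 0 < κ) (hp : 0 < p) (hm : 0 < m)
    (hpm : (κ + 1) * p = κ * m) {x : EuclideanSpace ℝ (Fin n)} (hx : ‖x‖ < ρ)
    (hd : DifferentiableAt ℝ (fun y : EuclideanSpace ℝ (Fin n) ↦ ‖y‖) x) :
    ‖gradient (barrier a κ ρ) x‖ ^ p + (1 - barrier a κ ρ x ^ 2) ^ m ≤
      ((2 * κ * a) ^ p + 4 ^ m) * (1 + depth ρ x) ^ (-(κ * m)) := by
  have h0 := depth_nonneg ρ x
  have h1 : ‖gradient (barrier a κ ρ) x‖ ^ p ≤ (2 * κ * a) ^ p * (1 + depth ρ x) ^ (-(κ * m)) := by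
    rw [norm_gradient_eq]
    refine (Real.rpow_le_rpow (norm_nonneg _) (norm_fderiv_barrier_le ha hκ hx hd) hp.le).trans_eq ?_
    rw [Real.mul_rpow (by positivity) (by positivity), ← Real.rpow_mul (by positivity), ← hpm]
    ring_nf
  have hb := barrier_mem_Icc ha hκ ρ x
  have h2 := potential_le_depth_rpow (m := m) ha hκ hm hb.1 hb.2 le_rfl
  linarith

theorem continuous_depth_rpow {E : Type*} [NormedAddCommGroup E] (ρ α : ℝ) :
    Continuous fun x : E ↦ (1 + depth ρ x) ^ (-α) :=
  (continuous_const.add (continuous_depth ρ)).rpow_const fun x ↦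
    Or.inl (by linarith [depth_nonneg ρ x] : 0 < 1 + depth ρ x).ne'

theorem integrableOn_depth_rpow (ρ α : ℝ) (hU : Bornology.IsBounded U) :
    IntegrableOn (fun x ↦ (1 + depth ρ x) ^ (-α)) U := by
  obtain ⟨r, hr⟩ := hU.subset_closedBall 0
  exact ((continuous_depth_rpow ρ α).continuousOn.integrableOn_compact
    (isCompact_closedBall 0 r)).mono_set hr

theorem Jpm_barrier_le (ha : 1 ≤ a) (hκ : 0 < κ) (hp : 0 < p) (hm : 0 < m)
    (hpm : (κ + 1) * p = κ * m) (hU : MeasurableSet U) (hUρ : U ⊆ ball 0 ρ) :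
    Jpm p m (barrier a κ ρ) U ≤
      ((2 * κ * a) ^ p + 4 ^ m) * ∫ x in U, (1 + depth ρ x) ^ (-(κ * m)) := by
  have hUb := isBounded_ball.subset hUρ
  rw [← integral_const_mul]
  refine integral_mono_ae (integrableOn_energy hp.le hm.le (barrier_mem_Icc ha hκ ρ)
    (locallyLipschitz_barrier ha κ ρ) hUb) ((integrableOn_depth_rpow ρ _ hUb).const_mul _) ?_
  refine (ae_restrict_iff' hU).2 ?_
  filter_upwards [lipschitzWith_one_norm.locallyLipschitz.ae_differentiableAt volume] with x hd hx
  exact energy_barrier_le ha hκ hp hm hpm (mem_ball_zero_iff.1 (hUρ hx)) hd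

theorem setIntegral_shell_depth_rpow_le {α : ℝ} (hα : 0 ≤ α) {A : Set (EuclideanSpace ℝ (Fin n))}
    (hA : MeasurableSet A) {j : ℝ} (hj : 0 ≤ j) :
    ∫ x in shell n (ρ - 1 - j) ∩ A, (1 + depth ρ x) ^ (-α) ≤
      (1 + j) ^ (-α) * volume.real (shell n (ρ - 1 - j) ∩ A) := by
  have hfin : volume (shell n (ρ - 1 - j) ∩ A) < ⊤ :=
    (measure_mono inter_subset_left).trans_lt (volume_shell_lt_top _)
  have hb : Bornology.IsBounded (shell n (ρ - 1 - j) ∩ A) :=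
    isBounded_ball.subset (inter_subset_left.trans sdiff_subset)
  calc _ ≤ ∫ x in shell n (ρ - 1 - j) ∩ A, (1 + j) ^ (-α) := by
        refine setIntegral_mono_on (integrableOn_depth_rpow ρ α hb)
          (integrableOn_const hfin.ne) ((measurableSet_shell _).inter hA) fun x hx ↦ ?_
        have h1 : ‖x‖ < ρ - 1 - j + 1 := mem_ball_zero_iff.1 hx.1.1
        have h2 : j ≤ depth ρ x := le_max_of_le_left (by linarith)
        exact Real.rpow_le_rpow_of_nonpos (by positivity) (by linarith) (by linarith)
    _ = _ := by rw [setIntegral_const, smul_eq_mul, mul_comm]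

end Energy

section Profile

variable {m : ℝ}

/-- The primitive of the potential `(1 - s²)^m` vanishing at the origin. -/
def potentialPrimitive (m t : ℝ) : ℝ := ∫ s in (0 : ℝ)..t, (1 - s ^ 2) ^ m

theorem continuous_potential (hm : 0 ≤ m) : Continuous fun s : ℝ ↦ (1 - s ^ 2) ^ m :=
  Continuous.rpow_const (by fun_prop) fun _ ↦ Or.inr hm

theorem hasDerivAt_potentialPrimitive (hm : 0 ≤ m) (t : ℝ) :
    HasDerivAt (potentialPrimitive m) ((1 - t ^ 2) ^ m) t :=
  (continuous_potential hm).integral_hasStrictDerivAt 0 t |>.hasDerivAt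

theorem locallyLipschitz_potentialPrimitive (hm : 0 ≤ m) :
    LocallyLipschitz (potentialPrimitive m) := by
  refine ContDiff.locallyLipschitz (𝕂 := ℝ) (contDiff_one_iff_deriv.2
    ⟨fun t ↦ (hasDerivAt_potentialPrimitive hm t).differentiableAt, ?_⟩)
  rw [funext fun t ↦ (hasDerivAt_potentialPrimitive hm t).deriv]
  exact continuous_potential hm

theorem strictMonoOn_potentialPrimitive (hm : 0 ≤ m) :
    StrictMonoOn (potentialPrimitive m) (Icc (-1) 1) := by
  refine strictMonoOn_of_deriv_pos (convex_Icc _ _)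
    (locallyLipschitz_potentialPrimitive hm).continuous.continuousOn fun t ht ↦ ?_
  rw [interior_Icc] at ht
  rw [(hasDerivAt_potentialPrimitive hm t).deriv]
  exact Real.rpow_pos_of_pos (by nlinarith [ht.1, ht.2]) _

end Profile

theorem mul_le_rpow_add {W g p : ℝ} (hW : W ∈ Icc (0 : ℝ) 1) (hg : 0 ≤ g) (hp : 1 ≤ p) :
    W * g ≤ g ^ p + W := by
  rcases le_total g 1 with h | h
  · have : 0 ≤ g ^ p := by positivity
    nlinarith [hW.1]
  · have : g ≤ g ^ p := by simpa using Real.rpow_le_rpow_of_exponent_le h hp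
    nlinarith [hW.1, hW.2]

section VolumeBound

variable {n : ℕ} {p m a κ ρ : ℝ} {u h : EuclideanSpace ℝ (Fin n) → ℝ}

/-- The excess of the primitive of the potential along `u` over that along `min u h`. -/
def excess (m : ℝ) (u h : EuclideanSpace ℝ (Fin n) → ℝ) (x : EuclideanSpace ℝ (Fin n)) : ℝ :=
  potentialPrimitive m (u x) - potentialPrimitive m (min (u x) (h x))

theorem locallyLipschitz_excess (hm : 0 ≤ m) (hul : LocallyLipschitz u)
    (hhl : LocallyLipschitz h) : LocallyLipschitz (excess m u h) :=
  ((locallyLipschitz_potentialPrimitive hm).comp hul).sub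
    ((locallyLipschitz_potentialPrimitive hm).comp (hul.min hhl))

theorem excess_nonneg (hm : 0 ≤ m) (hu : ∀ x, u x ∈ Icc (-1 : ℝ) 1)
    (hh : ∀ x, h x ∈ Icc (-1 : ℝ) 1) (x : EuclideanSpace ℝ (Fin n)) : 0 ≤ excess m u h x :=
  sub_nonneg.2 <| (strictMonoOn_potentialPrimitive hm).monotoneOn
    ⟨le_min (hu x).1 (hh x).1, min_le_of_left_le (hu x).2⟩ (hu x) (min_le_left _ _)

theorem excess_of_le {x : EuclideanSpace ℝ (Fin n)} (hx : u x ≤ h x) : excess m u h x = 0 := by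
  simp [excess, hx]

theorem fderiv_excess_of_le (hm : 0 ≤ m) (hu : ∀ x, u x ∈ Icc (-1 : ℝ) 1)
    (hh : ∀ x, h x ∈ Icc (-1 : ℝ) 1) {x : EuclideanSpace ℝ (Fin n)} (hx : u x ≤ h x) :
    fderiv ℝ (excess m u h) x = 0 :=
  IsLocalMin.fderiv_eq_zero <| Filter.Eventually.of_forall fun y ↦ by
    rw [excess_of_le hx]
    exact excess_nonneg hm hu hh y

theorem norm_fderiv_excess_le (hp : 1 ≤ p) (hm : 0 ≤ m) (hu : ∀ x, u x ∈ Icc (-1 : ℝ) 1)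
    (hh : ∀ x, h x ∈ Icc (-1 : ℝ) 1) {x : EuclideanSpace ℝ (Fin n)}
    (hud : DifferentiableAt ℝ u x) (hhd : DifferentiableAt ℝ h x)
    (hx : ∀ᶠ y in nhds x, h y ≤ u y) :
    ‖fderiv ℝ (excess m u h) x‖ ≤ (‖gradient u x‖ ^ p + (1 - u x ^ 2) ^ m) +
      (‖gradient h x‖ ^ p + (1 - h x ^ 2) ^ m) := by
  have heq : excess m u h =ᶠ[nhds x] fun y ↦
      potentialPrimitive m (u y) - potentialPrimitive m (h y) := by
    filter_upwards [hx] with y hy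
    simp [excess, hy]
  have hd : HasFDerivAt (fun y ↦ potentialPrimitive m (u y) - potentialPrimitive m (h y))
      ((1 - u x ^ 2) ^ m • fderiv ℝ u x - (1 - h x ^ 2) ^ m • fderiv ℝ h x) x :=
    ((hasDerivAt_potentialPrimitive hm (u x)).comp_hasFDerivAt x hud.hasFDerivAt).sub
    ((hasDerivAt_potentialPrimitive hm (h x)).comp_hasFDerivAt x hhd.hasFDerivAt)
  have hbound : ∀ v : EuclideanSpace ℝ (Fin n) → ℝ, v x ∈ Icc (-1 : ℝ) 1 →
      ‖(1 - v x ^ 2) ^ m • fderiv ℝ v x‖ ≤ ‖gradient v x‖ ^ p + (1 - v x ^ 2) ^ m := by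
    intro v hv
    have hW := potential_mem_Icc hm hv
    rw [norm_smul, Real.norm_of_nonneg hW.1, norm_gradient_eq]
    exact mul_le_rpow_add hW (norm_nonneg _) hp
  rw [heq.fderiv_eq, hd.fderiv]
  exact (norm_sub_le _ _).trans (add_le_add (hbound u (hu x)) (hbound h (hh x)))

theorem lintegral_fderiv_excess_le (hp : 1 ≤ p) (hm : 0 ≤ m) (hu : ∀ x, u x ∈ Icc (-1 : ℝ) 1)
    (hul : LocallyLipschitz u) (hh : ∀ x, h x ∈ Icc (-1 : ℝ) 1) (hhl : LocallyLipschitz h)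
    (hb : Bornology.IsBounded {x | h x < u x}) :
    ∫⁻ x, ‖fderiv ℝ (excess m u h) x‖ₑ ≤
      ENNReal.ofReal (Jpm p m u {x | h x < u x} + Jpm p m h {x | h x < u x}) := by
  have hopen : IsOpen {x | h x < u x} := isOpen_lt hhl.continuous hul.continuous
  have hp0 : 0 ≤ p := by linarith
  have hiu := integrableOn_energy hp0 hm hu hul hb
  have hih := integrableOn_energy hp0 hm hh hhl hb
  have hnn : ∀ v : EuclideanSpace ℝ (Fin n) → ℝ, (∀ x, v x ∈ Icc (-1 : ℝ) 1) → ∀ x,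
      0 ≤ ‖gradient v x‖ ^ p + (1 - v x ^ 2) ^ m := fun v hv x ↦
    add_nonneg (by positivity) (potential_mem_Icc hm (hv x)).1
  have hsum : IntegrableOn (fun x ↦ (‖gradient u x‖ ^ p + (1 - u x ^ 2) ^ m) +
      (‖gradient h x‖ ^ p + (1 - h x ^ 2) ^ m)) {x | h x < u x} := hiu.add hih
  rw [Jpm, Jpm, ← integral_add hiu hih, ofReal_integral_eq_lintegral_ofReal hsum
    (Filter.Eventually.of_forall fun x ↦ add_nonneg (hnn u hu x) (hnn h hh x)),
    ← lintegral_indicator hopen.measurableSet]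
  refine lintegral_mono_ae ?_
  filter_upwards [hul.ae_differentiableAt volume, hhl.ae_differentiableAt volume] with x hud hhd
  by_cases hx : h x < u x
  · have hxU : x ∈ {x | h x < u x} := hx
    rw [indicator_of_mem hxU, ← ofReal_norm]
    refine ENNReal.ofReal_le_ofReal (norm_fderiv_excess_le hp hm hu hh hud hhd ?_)
    filter_upwards [hopen.mem_nhds hx] with y hy using le_of_lt hy
  · rw [fderiv_excess_of_le hm hu hh (not_lt.1 hx)]
    rw [← ofReal_norm, norm_zero, ENNReal.ofReal_zero]
    exact zero_le

/-- The volume of `{u ≥ 0}` in the region where the barrier is below `-1/2` is controlled by a power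
of the energies of `u` and the barrier on the set where `u` exceeds the barrier. -/
theorem exists_volume_le_energy (hn : 2 ≤ n) (hp : 1 ≤ p) (hm : 0 ≤ m) :
    ∃ K : ℝ, 0 ≤ K ∧ ∀ (u h : EuclideanSpace ℝ (Fin n) → ℝ) (r : ℝ),
      (∀ x, u x ∈ Icc (-1 : ℝ) 1) → LocallyLipschitz u →
      (∀ x, h x ∈ Icc (-1 : ℝ) 1) → LocallyLipschitz h → Bornology.IsBounded {x | h x < u x} →
      (∀ x ∈ ball 0 r, h x ≤ -(1 / 2)) →
      volume.real (ball (0 : EuclideanSpace ℝ (Fin n)) r ∩ {x | 0 ≤ u x}) ≤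
        K * (Jpm p m u {x | h x < u x} + Jpm p m h {x | h x < u x}) ^ ((n : ℝ) / (n - 1)) := by
  set q : ℝ := (n : ℝ) / (n - 1) with hq
  have hn1 : (1 : ℝ) < n := by exact_mod_cast hn
  have hconj : Real.HolderConjugate (Module.finrank ℝ (EuclideanSpace ℝ (Fin n))) q := by
    rw [finrank_euclideanSpace_fin]
    exact Real.HolderConjugate.conjExponent hn1
  have hq0 : 0 < q := hconj.symm.pos
  have hstrict := strictMonoOn_potentialPrimitive hm
  set δ : ℝ := potentialPrimitive m 0 - potentialPrimitive m (-(1 / 2)) with hδ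
  have hδ0 : 0 < δ := sub_pos.2 (hstrict (by norm_num) (by norm_num) (by norm_num))
  set C : ℝ := (lintegralPowLePowLIntegralFDerivConst
    (volume : Measure (EuclideanSpace ℝ (Fin n))) q : ℝ) with hC
  refine ⟨C / δ ^ q, by positivity, fun u h r hu hul hh hhl hb hhr ↦ ?_⟩
  set J : ℝ := Jpm p m u {x | h x < u x} + Jpm p m h {x | h x < u x} with hJ
  have hJ0 : 0 ≤ J := add_nonneg
    (integral_nonneg fun x ↦ add_nonneg (by positivity) (potential_mem_Icc hm (hu x)).1)
    (integral_nonneg fun x ↦ add_nonneg (by positivity) (potential_mem_Icc hm (hh x)).1)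
  have hsupp : HasCompactSupport (excess m u h) := by
    obtain ⟨s, hs⟩ := hb.subset_closedBall 0
    refine HasCompactSupport.intro (isCompact_closedBall 0 s) fun x hx ↦ excess_of_le ?_
    exact not_lt.1 fun hlt ↦ hx (hs hlt)
  set A := ball (0 : EuclideanSpace ℝ (Fin n)) r ∩ {x | 0 ≤ u x} with hA
  have hAm : MeasurableSet A :=
    measurableSet_ball.inter (measurableSet_le measurable_const hul.continuous.measurable)
  have hAfin : volume A < ⊤ := (measure_mono inter_subset_left).trans_lt measure_ball_lt_top
  have hlow : ENNReal.ofReal (δ ^ q) * volume A ≤ ∫⁻ x, ‖excess m u h x‖ₑ ^ q := by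
    rw [← setLIntegral_const]
    refine (setLIntegral_mono' hAm fun x hx ↦ ?_).trans (setLIntegral_le_lintegral A _)
    rw [← ENNReal.ofReal_rpow_of_pos hδ0]
    refine ENNReal.rpow_le_rpow ?_ hq0.le
    rw [Real.enorm_of_nonneg (excess_nonneg hm hu hh x)]
    refine ENNReal.ofReal_le_ofReal ?_
    have h1 : h x ≤ -(1 / 2) := hhr x hx.1
    have h2 : 0 ≤ u x := hx.2
    rw [excess, min_eq_right (by linarith)]
    exact sub_le_sub (hstrict.monotoneOn (by norm_num) (hu x) h2)
      (hstrict.monotoneOn (hh x) (by norm_num) h1)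
  have hmain := hlow.trans (((locallyLipschitz_excess hm hul
    hhl).lintegral_pow_le_pow_lintegral_fderiv volume hsupp hconj).trans (mul_le_mul' le_rfl
      (ENNReal.rpow_le_rpow (lintegral_fderiv_excess_le hp hm hu hul hh hhl hb) hq0.le)))
  rw [← hJ, ENNReal.ofReal_rpow_of_nonneg hJ0 hq0.le] at hmain
  have hreal := ENNReal.toReal_mono
    (ENNReal.mul_ne_top ENNReal.coe_ne_top ENNReal.ofReal_ne_top) hmain
  rw [ENNReal.toReal_mul, ENNReal.toReal_mul, ENNReal.toReal_ofReal (by positivity),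
    ENNReal.toReal_ofReal (by positivity), ENNReal.coe_toReal, ← hC] at hreal
  rw [div_mul_eq_mul_div, le_div_iff₀ (by positivity), mul_comm]
  exact hreal

end VolumeBound

section Growth

variable {n : ℕ} {p m Q a κ γ ρ r s : ℝ} {u : EuclideanSpace ℝ (Fin n) → ℝ}

theorem Ppot_mono (hm : 0 ≤ m) (hu : ∀ x, u x ∈ Icc (-1 : ℝ) 1) (huc : Continuous u)
    (h : r ≤ s) : Ppot m u r ≤ Ppot m u s :=
  setIntegral_mono_set (integrableOn_potential hm hu huc isBounded_ball)
    (Filter.Eventually.of_forall fun x ↦ (potential_mem_Icc hm (hu x)).1)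
    (LE.le.eventuallyLE (ball_subset_ball h))

theorem Vvol_mono (u : EuclideanSpace ℝ (Fin n) → ℝ) (h : r ≤ s) : Vvol u r ≤ Vvol u s :=
  measureReal_mono (inter_subset_inter_left _ (ball_subset_ball h))
    ((measure_mono inter_subset_left).trans_lt measure_ball_lt_top).ne

theorem Ppot_sub_eq (hm : 0 ≤ m) (hu : ∀ x, u x ∈ Icc (-1 : ℝ) 1) (huc : Continuous u) (r : ℝ) :
    Ppot m u (r + 1) - Ppot m u r = ∫ x in shell n r, (1 - u x ^ 2) ^ m :=
  (setIntegral_sdiff measurableSet_ball (integrableOn_potential hm hu huc isBounded_ball)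
    (ball_subset_ball (by linarith))).symm

theorem Vvol_sub_eq (huc : Continuous u) (r : ℝ) :
    Vvol u (r + 1) - Vvol u r = volume.real (shell n r ∩ {x | 0 ≤ u x}) := by
  have hA : MeasurableSet {x | 0 ≤ u x} := measurableSet_le measurable_const huc.measurable
  rw [shell, inter_sdiff_distrib_right, measureReal_sdiff
    (inter_subset_inter_left _ (ball_subset_ball (by linarith))) (measurableSet_ball.inter hA)
    ((measure_mono inter_subset_left).trans_lt measure_ball_lt_top).ne]
  rfl

theorem setIntegral_shell_depth_rpow_le_sub (ha : 1 ≤ a) (hκ : 0 < κ) (hak : a ^ (-κ) = 1 / 4)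
    (hm : 0 < m) (hu : ∀ x, u x ∈ Icc (-1 : ℝ) 1) (hul : LocallyLipschitz u) {j : ℝ} (hj : 0 ≤ j) :
    ∫ x in shell n (ρ - 1 - j) ∩ {x | barrier a κ ρ x < u x}, (1 + depth ρ x) ^ (-(κ * m)) ≤
      2 ^ m * (Ppot m u (ρ - 1 - j + 1) - Ppot m u (ρ - 1 - j)) +
        (1 + j) ^ (-(κ * m)) * (Vvol u (ρ - 1 - j + 1) - Vvol u (ρ - 1 - j)) := by
  set S := shell n (ρ - 1 - j) with hS
  have hSm : MeasurableSet S := measurableSet_shell _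
  have hSb : Bornology.IsBounded S := isBounded_ball.subset sdiff_subset
  have hUm := (isOpen_setOf_barrier_lt (κ := κ) (ρ := ρ) ha hul).measurableSet
  have hA : MeasurableSet {x | 0 ≤ u x} := measurableSet_le measurable_const hul.continuous.measurable
  have hω : ∀ x : EuclideanSpace ℝ (Fin n), 0 ≤ (1 + depth ρ x) ^ (-(κ * m)) := fun x ↦
    Real.rpow_nonneg (by linarith [depth_nonneg ρ x]) _
  have hSUb : Bornology.IsBounded (S ∩ {x | barrier a κ ρ x < u x}) := hSb.subset inter_subset_left
  have hWS : IntegrableOn (fun x ↦ 2 ^ m * (1 - u x ^ 2) ^ m) S :=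
    (integrableOn_potential hm.le hu hul.continuous hSb).const_mul (2 ^ m)
  rw [Ppot_sub_eq hm.le hu hul.continuous, Vvol_sub_eq hul.continuous,
    ← integral_inter_add_sdiff hA (integrableOn_depth_rpow ρ (κ * m) hSUb), add_comm]
  refine add_le_add ?_ ?_
  · rw [← integral_const_mul]
    calc _ ≤ ∫ x in (S ∩ {x | barrier a κ ρ x < u x}) \ {x | 0 ≤ u x}, 2 ^ m * (1 - u x ^ 2) ^ m := by
          refine setIntegral_mono_on (integrableOn_depth_rpow ρ (κ * m) (hSUb.subset sdiff_subset))
            (hWS.mono_set (sdiff_subset.trans inter_subset_left)) ((hSm.inter hUm).diff hA)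
            fun x hx ↦ ?_
          exact depth_rpow_le_potential ha hκ hak hm (not_le.1 hx.2).le (le_of_lt hx.1.2)
      _ ≤ _ := setIntegral_mono_set hWS
          (Filter.Eventually.of_forall fun x ↦
            mul_nonneg (by positivity) (potential_mem_Icc hm.le (hu x)).1)
          (LE.le.eventuallyLE (sdiff_subset.trans inter_subset_left))
  · refine le_trans ?_ (setIntegral_shell_depth_rpow_le (by positivity) hA hj)
    exact setIntegral_mono_set
      (integrableOn_depth_rpow ρ (κ * m) (hSb.subset inter_subset_left))
      (Filter.Eventually.of_forall hω)
      (LE.le.eventuallyLE (inter_subset_inter_left _ inter_subset_left))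

theorem setIntegral_shell_depth_rpow_le_pow (hn : n ≠ 0) {α : ℝ} (hα : 0 ≤ α)
    {A : Set (EuclideanSpace ℝ (Fin n))} (hA : MeasurableSet A) {R j : ℝ} (hR : 1 ≤ R) (hj : 0 ≤ j)
    (hjR : j ≤ R) :
    ∫ x in shell n (R + 1 - 1 - j) ∩ A, (1 + depth (R + 1) x) ^ (-α) ≤
      (1 + j) ^ (-α) * (n * 2 ^ (n - 1) *
        volume.real (ball (0 : EuclideanSpace ℝ (Fin n)) 1) * R ^ (n - 1)) := by
  refine (setIntegral_shell_depth_rpow_le hα hA hj).trans ?_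
  gcongr
  calc _ ≤ volume.real (shell n (R + 1 - 1 - j)) :=
        measureReal_mono inter_subset_left (volume_shell_lt_top _).ne
    _ ≤ n * (2 * R) ^ (n - 1) * volume.real (ball (0 : EuclideanSpace ℝ (Fin n)) 1) :=
        volume_real_shell_le hn (by linarith) (by linarith)
    _ = _ := by rw [mul_pow]; ring

theorem setIntegral_ball_depth_rpow_le (hn : n ≠ 0) (hγ : 0 < γ) {R : ℕ} (hR : 1 ≤ R) :
    ∫ x in ball (0 : EuclideanSpace ℝ (Fin n)) (R + 1), (1 + depth (R + 1) x) ^ (-(γ + 1)) ≤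
      (2 + γ⁻¹) * (n * 2 ^ (n - 1) *
        volume.real (ball (0 : EuclideanSpace ℝ (Fin n)) 1) * (R : ℝ) ^ (n - 1)) := by
  have h := setIntegral_ball_inter_eq_sum_shell (n := n) (R + 1) MeasurableSet.univ
    (integrableOn_depth_rpow (R + 1 : ℝ) (γ + 1) isBounded_ball)
  rw [inter_univ] at h
  push_cast at h
  rw [h]
  refine (Finset.sum_le_sum fun j hj ↦ setIntegral_shell_depth_rpow_le_pow hn (by positivity)
    MeasurableSet.univ (by exact_mod_cast hR) (Nat.cast_nonneg j) ?_).trans ?_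
  · exact_mod_cast Nat.lt_succ_iff.1 (Finset.mem_range.1 hj)
  · rw [← Finset.sum_mul]
    gcongr
    exact sum_range_one_add_rpow_neg_le hγ _

theorem Mseq_sub_eq (p m : ℝ) (u : EuclideanSpace ℝ (Fin n) → ℝ) (T : ℕ) (R : ℝ) :
    Mseq p m u T (R + 1) - Mseq p m u T R = ∑ j ∈ Finset.range (T + 1),
      ((Ppot m u (R + 1 - 1 - j + 1) - Ppot m u (R + 1 - 1 - j)) +
        (1 + (j : ℝ)) ^ (-(p * m / (m - p))) *
          (Vvol u (R + 1 - 1 - j + 1) - Vvol u (R + 1 - 1 - j))) := by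
  rw [Mseq, Mseq, ← Finset.sum_sub_distrib]
  refine Finset.sum_congr rfl fun j _ ↦ ?_
  rw [show R + 1 - 1 - (j : ℝ) + 1 = R + 1 - j by ring, show R + 1 - 1 - (j : ℝ) = R - j by ring]
  ring

theorem setIntegral_depth_rpow_le_Mseq_sub (hn : n ≠ 0) (ha : 1 ≤ a) (hκ : 0 < κ)
    (hak : a ^ (-κ) = 1 / 4) (hm : 0 < m) (hγ : 0 < γ) (hκm : κ * m = γ + 1)
    (hpm : p * m / (m - p) = γ + 1) (hu : ∀ x, u x ∈ Icc (-1 : ℝ) 1) (hul : LocallyLipschitz u)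
    {R T : ℕ} (hT : 1 ≤ T) (hTR : T ≤ R) :
    ∫ x in {x | barrier a κ (R + 1) x < u x}, (1 + depth (R + 1 : ℝ) x) ^ (-(γ + 1)) ≤
      (2 ^ m + n * 2 ^ (n - 1) *
        volume.real (ball (0 : EuclideanSpace ℝ (Fin n)) 1) * γ⁻¹) *
        ((R : ℝ) ^ (n - 1) * (T : ℝ) ^ (-γ) +
          (Mseq p m u T ((R : ℝ) + 1) - Mseq p m u T (R : ℝ))) := by
  set D : ℝ := n * 2 ^ (n - 1) * volume.real (ball (0 : EuclideanSpace ℝ (Fin n)) 1) with hD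
  have hD0 : 0 ≤ D := by positivity
  set U := {x | barrier a κ ((R : ℝ) + 1) x < u x} with hU
  have hUm : MeasurableSet U := (isOpen_setOf_barrier_lt ha hul).measurableSet
  have h := setIntegral_ball_inter_eq_sum_shell (n := n) (R + 1) hUm
    (integrableOn_depth_rpow (R + 1 : ℝ) (γ + 1) isBounded_ball)
  push_cast at h
  rw [inter_eq_right.2 (setOf_barrier_lt_subset_ball hu)] at h
  have h2m : (1 : ℝ) ≤ 2 ^ m := Real.one_le_rpow (by norm_num) hm.le
  have hΔ : ∀ j : ℕ, 0 ≤ Ppot m u (R + 1 - 1 - j + 1 : ℝ) - Ppot m u (R + 1 - 1 - j : ℝ) ∧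
      0 ≤ (1 + (j : ℝ)) ^ (-(γ + 1)) *
        (Vvol u (R + 1 - 1 - j + 1 : ℝ) - Vvol u (R + 1 - 1 - j : ℝ)) := fun j ↦
    ⟨sub_nonneg.2 (Ppot_mono hm.le hu hul.continuous (by linarith)),
      mul_nonneg (by positivity) (sub_nonneg.2 (Vvol_mono u (by linarith)))⟩
  have hM := Mseq_sub_eq p m u T R
  rw [hpm] at hM
  have hM0 : 0 ≤ Mseq p m u T ((R : ℝ) + 1) - Mseq p m u T (R : ℝ) := by
    rw [hM]
    exact Finset.sum_nonneg fun j _ ↦ add_nonneg (hΔ j).1 (hΔ j).2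
  have hhead : ∑ j ∈ Finset.range (T + 1), ∫ x in shell n (R + 1 - 1 - j : ℝ) ∩ U,
      (1 + depth (R + 1 : ℝ) x) ^ (-(γ + 1)) ≤
      2 ^ m * (Mseq p m u T ((R : ℝ) + 1) - Mseq p m u T (R : ℝ)) := by
    rw [hM, Finset.mul_sum]
    refine Finset.sum_le_sum fun j _ ↦ ?_
    have := setIntegral_shell_depth_rpow_le_sub (ρ := R + 1) ha hκ hak hm hu hul
      (Nat.cast_nonneg (α := ℝ) j)
    rw [hκm] at this
    refine this.trans ?_
    rw [mul_add]
    exact add_le_add le_rfl (le_mul_of_one_le_left (hΔ j).2 h2m)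
  have htail : ∑ j ∈ Finset.Ico (T + 1) (R + 1), ∫ x in shell n (R + 1 - 1 - j : ℝ) ∩ U,
      (1 + depth (R + 1 : ℝ) x) ^ (-(γ + 1)) ≤
      D * γ⁻¹ * ((R : ℝ) ^ (n - 1) * (T : ℝ) ^ (-γ)) := by
    refine (Finset.sum_le_sum fun j hj ↦ setIntegral_shell_depth_rpow_le_pow hn (by positivity)
      hUm (by exact_mod_cast hT.trans hTR) (Nat.cast_nonneg j) ?_).trans ?_
    · exact_mod_cast Nat.lt_succ_iff.1 (Finset.mem_Ico.1 hj).2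
    · rw [← Finset.sum_mul, ← hD]
      calc _ ≤ (γ⁻¹ * (T : ℝ) ^ (-γ)) * (D * (R : ℝ) ^ (n - 1)) := by
            gcongr
            exact sum_Ico_one_add_rpow_neg_le hγ hT (by omega)
        _ = _ := by ring
  rw [h, ← Finset.sum_range_add_sum_Ico _ (by omega : T + 1 ≤ R + 1)]
  have hX : 0 ≤ (R : ℝ) ^ (n - 1) * (T : ℝ) ^ (-γ) := by positivity
  have hDγ : 0 ≤ D * γ⁻¹ := by positivity
  nlinarith [mul_nonneg hDγ hM0, mul_nonneg (zero_le_one.trans h2m) hX]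

theorem Ppot_le_depth_integral (ha : 1 ≤ a) (hκ : 0 < κ) (hp : 0 < p) (hm : 0 < m)
    (hpm : (κ + 1) * p = κ * m) (hQ : 0 ≤ Q) (hu : ∀ x, u x ∈ Icc (-1 : ℝ) 1)
    (hul : LocallyLipschitz u) (hmin : IsQMinEntire p m Q u) (ρ : ℝ) :
    Ppot m u ρ ≤ (Q * ((2 * κ * a) ^ p + 4 ^ m) + 4 ^ m) *
      ∫ x in ball (0 : EuclideanSpace ℝ (Fin n)) ρ, (1 + depth ρ x) ^ (-(κ * m)) := by
  set U := {x | barrier a κ ρ x < u x} with hU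
  have hUρ : U ⊆ ball 0 ρ := setOf_barrier_lt_subset_ball hu
  have hUm : MeasurableSet U := (isOpen_setOf_barrier_lt ha hul).measurableSet
  have hUb : Bornology.IsBounded U := isBounded_ball.subset hUρ
  have hω : ∀ x : EuclideanSpace ℝ (Fin n), 0 ≤ (1 + depth ρ x) ^ (-(κ * m)) := fun x ↦
    Real.rpow_nonneg (by linarith [depth_nonneg ρ x]) _
  have hW : IntegrableOn (fun x ↦ (1 - u x ^ 2) ^ m) (ball 0 ρ) :=
    integrableOn_potential hm.le hu hul.continuous isBounded_ball
  have hωi : IntegrableOn (fun x ↦ (1 + depth ρ x) ^ (-(κ * m)))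
    (ball (0 : EuclideanSpace ℝ (Fin n)) ρ) := integrableOn_depth_rpow ρ _ isBounded_ball
  have hωU : ∫ x in U, (1 + depth ρ x) ^ (-(κ * m)) ≤
      ∫ x in ball (0 : EuclideanSpace ℝ (Fin n)) ρ, (1 + depth ρ x) ^ (-(κ * m)) :=
    setIntegral_mono_set hωi (Filter.Eventually.of_forall hω)
      (LE.le.eventuallyLE hUρ)
  have h1 : ∫ x in ball 0 ρ ∩ U, (1 - u x ^ 2) ^ m ≤
      Q * ((2 * κ * a) ^ p + 4 ^ m) *
        ∫ x in ball (0 : EuclideanSpace ℝ (Fin n)) ρ, (1 + depth ρ x) ^ (-(κ * m)) := by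
    rw [inter_eq_right.2 hUρ]
    calc _ ≤ Jpm p m u U := by
          refine setIntegral_mono_on (hW.mono_set hUρ)
            (integrableOn_energy hp.le hm.le hu hul hUb) hUm fun x _ ↦ ?_
          exact le_add_of_nonneg_left (by positivity)
      _ ≤ Q * Jpm p m (barrier a κ ρ) U := hmin.Jpm_le_barrier hu hul ha hκ
      _ ≤ Q * (((2 * κ * a) ^ p + 4 ^ m) * ∫ x in U, (1 + depth ρ x) ^ (-(κ * m))) := by
          gcongr
          exact Jpm_barrier_le ha hκ hp hm hpm hUm hUρ
      _ ≤ _ := by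
          rw [← mul_assoc]
          gcongr
  have hωi' : IntegrableOn (fun x ↦ 4 ^ m * (1 + depth ρ x) ^ (-(κ * m)))
    (ball (0 : EuclideanSpace ℝ (Fin n)) ρ) := hωi.const_mul _
  have h2 : ∫ x in ball 0 ρ \ U, (1 - u x ^ 2) ^ m ≤
      4 ^ m * ∫ x in ball (0 : EuclideanSpace ℝ (Fin n)) ρ, (1 + depth ρ x) ^ (-(κ * m)) := by
    rw [← integral_const_mul]
    calc _ ≤ ∫ x in ball 0 ρ \ U, 4 ^ m * (1 + depth ρ x) ^ (-(κ * m)) := by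
          refine setIntegral_mono_on (hW.mono_set sdiff_subset)
            (hωi'.mono_set sdiff_subset) (measurableSet_ball.diff hUm) fun x hx ↦ ?_
          exact potential_le_depth_rpow ha hκ hm (hu x).1 (hu x).2 (not_lt.1 hx.2)
      _ ≤ _ := setIntegral_mono_set hωi'
          (Filter.Eventually.of_forall fun x ↦ mul_nonneg (by positivity) (hω x))
          (LE.le.eventuallyLE sdiff_subset)
  rw [Ppot, ← integral_inter_add_sdiff hUm hW, add_mul]
  exact add_le_add h1 h2

theorem Mseq_le (hm : 0 ≤ m) (hγ : 0 < γ) (hpm : p * m / (m - p) = γ + 1)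
    (hu : ∀ x, u x ∈ Icc (-1 : ℝ) 1) (huc : Continuous u) (T : ℕ) (r : ℝ) :
    Mseq p m u T r ≤ (T + 1) * Ppot m u r + (2 + γ⁻¹) * Vvol u r := by
  have hV : 0 ≤ Vvol u r := ENNReal.toReal_nonneg
  have hj : ∀ j : ℕ, r - j ≤ r := fun j ↦ by linarith [Nat.cast_nonneg (α := ℝ) j]
  calc Mseq p m u T r ≤ ∑ j ∈ Finset.range (T + 1),
        (Ppot m u r + (1 + (j : ℝ)) ^ (-(γ + 1)) * Vvol u r) := by
        rw [Mseq, hpm]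
        refine Finset.sum_le_sum fun j _ ↦ add_le_add (Ppot_mono hm hu huc (hj j)) ?_
        gcongr
        exact Vvol_mono u (hj j)
    _ ≤ _ := by
        rw [Finset.sum_add_distrib, ← Finset.sum_mul, Finset.sum_const, Finset.card_range,
          nsmul_eq_mul]
        push_cast
        gcongr
        exact sum_range_one_add_rpow_neg_le hγ _

end Growth

/-- The discrete differential inequality (2.31) in the paper, with
`γ = pm/(m-p) - 1`. -/
theorem discrete_inequality
    (n : ℕ) (hn : 2 ≤ n) (p m Q : ℝ)
    (hp : 1 < p) (hpm : p < m) (hQ : 1 ≤ Q) :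
    ∃ c₁ > (0 : ℝ), ∃ C₀ > (0 : ℝ),
      ∀ u : EuclideanSpace ℝ (Fin n) → ℝ,
        (∀ x, u x ∈ Icc (-1 : ℝ) 1) → LocallyLipschitz u → IsQMinEntire p m Q u →
        ∀ R T : ℕ, 1 ≤ T → 2 * T ≤ R →
          c₁ * (max (Mseq p m u T ((R : ℝ) - T) - C₀ * (T : ℝ) * (R : ℝ) ^ (n - 1)) 0) ^
              ((n - 1 : ℝ) / n) ≤
            (R : ℝ) ^ (n - 1) * (T : ℝ) ^ (-(p * m / (m - p) - 1)) +
              (Mseq p m u T ((R : ℝ) + 1) - Mseq p m u T (R : ℝ)) := by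
  set γ : ℝ := p * m / (m - p) - 1 with hγdef
  set κ : ℝ := p / (m - p) with hκdef
  have hp0 : 0 < p := by linarith
  have hm : 0 < m := by linarith
  have hmp : 0 < m - p := by linarith
  have hn0 : n ≠ 0 := by omega
  have hκ : 0 < κ := by positivity
  have hγ : 0 < γ := by
    rw [hγdef, sub_pos, one_lt_div hmp]
    nlinarith
  have hpmγ : p * m / (m - p) = γ + 1 := by rw [hγdef]; ring
  have hκm : κ * m = γ + 1 := by rw [← hpmγ, hκdef]; ring
  have hκp : (κ + 1) * p = κ * m := by
    rw [hκdef]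
    field_simp
    ring
  obtain ⟨a, ha, hak⟩ := exists_rpow_neg_eq_quarter hκ
  obtain ⟨K, hK0, hK⟩ := exists_volume_le_energy (p := p) (m := m) hn hp.le hm.le
  set D : ℝ := n * 2 ^ (n - 1) * volume.real (ball (0 : EuclideanSpace ℝ (Fin n)) 1) with hD
  set B : ℝ := (2 * κ * a) ^ p + 4 ^ m with hB
  set q : ℝ := (n : ℝ) / (n - 1) with hq
  have hn1 : (1 : ℝ) < n := by exact_mod_cast hn
  have hq0 : 0 < q := div_pos (by linarith) (by linarith)
  have hqinv : ((n : ℝ) - 1) / n = q⁻¹ := by rw [hq, inv_div]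
  have hD0 : 0 ≤ D := by positivity
  have hB0 : 0 < B := by positivity
  -- the constants relating the volume, the potential energy and the right-hand side
  set C₁ : ℝ := 2 ^ m + D * γ⁻¹ with hC₁
  set C₂ : ℝ := (Q * B + 4 ^ m) * ((2 + γ⁻¹) * D) with hC₂
  set C₃ : ℝ := (2 + γ⁻¹) * (K + 1) with hC₃
  set C₄ : ℝ := (Q + 1) * B * C₁ with hC₄
  have hC₁0 : 0 < C₁ := by positivity
  have hC₂0 : 0 ≤ C₂ := by positivity
  have hC₃0 : 0 < C₃ := by positivity
  have hC₄0 : 0 < C₄ := by positivity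
  have hpow : 0 < C₃ ^ q⁻¹ := Real.rpow_pos_of_pos hC₃0 _
  refine ⟨(C₃ ^ q⁻¹ * C₄)⁻¹, by positivity, 2 * C₂ + 1, by positivity, ?_⟩
  intro u hu hul hmin R T hT hTR
  have hT1 : (1 : ℝ) ≤ T := by exact_mod_cast hT
  have hR1 : 1 ≤ R := by omega
  set G : ℝ := (R : ℝ) ^ (n - 1) * (T : ℝ) ^ (-γ) +
    (Mseq p m u T ((R : ℝ) + 1) - Mseq p m u T (R : ℝ)) with hG
  set U := {x | barrier a κ ((R : ℝ) + 1) x < u x} with hU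
  have hUm : MeasurableSet U := (isOpen_setOf_barrier_lt ha hul).measurableSet
  have hUρ : U ⊆ ball 0 ((R : ℝ) + 1) := setOf_barrier_lt_subset_ball hu
  have hI := setIntegral_depth_rpow_le_Mseq_sub hn0 ha hκ hak hm hγ hκm hpmγ hu hul hT
    (by omega : T ≤ R)
  rw [← hD, ← hC₁, ← hG, ← hU] at hI
  have hI0 : 0 ≤ ∫ x in U, (1 + depth (R + 1 : ℝ) x) ^ (-(γ + 1)) :=
    integral_nonneg fun x ↦ Real.rpow_nonneg (by linarith [depth_nonneg (R + 1 : ℝ) x]) _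
  have hG0 : 0 ≤ G := nonneg_of_mul_nonneg_right (hI0.trans hI) hC₁0
  have hJh : Jpm p m (barrier a κ ((R : ℝ) + 1)) U ≤ B * (C₁ * G) := by
    refine (Jpm_barrier_le ha hκ hp0 hm hκp hUm hUρ).trans ?_
    rw [hκm]
    gcongr
  have hJ : Jpm p m u U + Jpm p m (barrier a κ ((R : ℝ) + 1)) U ≤ C₄ * G := by
    have h1 := hmin.Jpm_le_barrier (ρ := (R : ℝ) + 1) hu hul ha hκ
    have h2 : (Q + 1) * Jpm p m (barrier a κ ((R : ℝ) + 1)) U ≤ (Q + 1) * (B * (C₁ * G)) := by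
      gcongr
    calc _ ≤ (Q + 1) * Jpm p m (barrier a κ ((R : ℝ) + 1)) U := by rw [← hU] at h1; linarith
      _ ≤ _ := h2
      _ = C₄ * G := by rw [hC₄]; ring
  have hJ0 : 0 ≤ Jpm p m u U + Jpm p m (barrier a κ ((R : ℝ) + 1)) U := add_nonneg
    (integral_nonneg fun x ↦ add_nonneg (by positivity) (potential_mem_Icc hm.le (hu x)).1)
    (integral_nonneg fun x ↦ add_nonneg (by positivity)
      (potential_mem_Icc hm.le (barrier_mem_Icc ha hκ _ x)).1)
  have hV : Vvol u R ≤ (K + 1) * (C₄ * G) ^ q := by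
    have h := hK u (barrier a κ ((R : ℝ) + 1)) R hu hul (barrier_mem_Icc ha hκ _)
      (locallyLipschitz_barrier ha κ _) (isBounded_ball.subset hUρ) fun x hx ↦
        barrier_le_of_norm_le ha hκ hak (by
          have := mem_ball_zero_iff.1 hx
          linarith)
    refine h.trans ?_
    gcongr
    linarith
  have hP : Ppot m u R ≤ C₂ * (R : ℝ) ^ (n - 1) := by
    have h := Ppot_le_depth_integral ha hκ hp0 hm hκp (by linarith : 0 ≤ Q) hu hul hmin (R + 1)
    rw [hκm, ← hB] at h
    refine (Ppot_mono hm.le hu hul.continuous (by linarith : (R : ℝ) ≤ R + 1)).trans (h.trans ?_)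
    calc _ ≤ (Q * B + 4 ^ m) * ((2 + γ⁻¹) * (D * (R : ℝ) ^ (n - 1))) := by
          gcongr
          exact setIntegral_ball_depth_rpow_le hn0 hγ hR1
      _ = _ := by rw [hC₂]; ring
  have hRT : (R : ℝ) - T ≤ R := by linarith
  have hM : max (Mseq p m u T ((R : ℝ) - T) - (2 * C₂ + 1) * (T : ℝ) * (R : ℝ) ^ (n - 1)) 0 ≤
      C₃ * (C₄ * G) ^ q := by
    refine max_le ?_ (by positivity)
    have h1 := Mseq_le hm.le hγ hpmγ hu hul.continuous T ((R : ℝ) - T)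
    have h2 : (T + 1 : ℝ) * Ppot m u ((R : ℝ) - T) ≤ (2 * T) * (C₂ * (R : ℝ) ^ (n - 1)) := by
      refine mul_le_mul (by linarith) ((Ppot_mono hm.le hu hul.continuous hRT).trans hP) ?_
        (by positivity)
      exact integral_nonneg fun x ↦ (potential_mem_Icc hm.le (hu x)).1
    have h3 : (2 + γ⁻¹) * Vvol u ((R : ℝ) - T) ≤ (2 + γ⁻¹) * ((K + 1) * (C₄ * G) ^ q) := by
      gcongr
      exact (Vvol_mono u hRT).trans hV
    have h4 : 0 ≤ (T : ℝ) * (R : ℝ) ^ (n - 1) := by positivity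
    rw [hC₃, mul_assoc (2 + γ⁻¹)]
    linarith
  rw [hqinv, inv_mul_le_iff₀ (by positivity)]
  calc _ ≤ (C₃ * (C₄ * G) ^ q) ^ q⁻¹ :=
        Real.rpow_le_rpow (le_max_right _ _) hM (by positivity)
    _ = C₃ ^ q⁻¹ * C₄ * G := by
        rw [Real.mul_rpow hC₃0.le (by positivity), Real.rpow_rpow_inv (by positivity) hq0.ne']
        exact (mul_assoc _ _ _).symm
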